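/- arXiv:math/0210467 — 3 statements merged into one kernel-verified Lean document; each statement's English description precedes it below -/
import Mathlib

section
/- For every subgroup Γ₀ of finite index in SL(2,ℤ), the action of Γ₀ on the 2-torus 𝕋² = (ℝ/ℤ)² is ergodic with respect to the Haar probability measure μ: every measurable set E ⊆ 𝕋² with μ((A·E) Δ E) = 0 for all A ∈ Γ₀ satisfies μ(E) = 0 or μ(E) = 1. -/
open Matrix Filter MeasureTheory
open scoped ComplexOrder symmDiff

abbrev SL2Z := Matrix.SpecialLinearGroup (Fin 2) ℤ

/-- The `2`-torus `𝕋² = (ℝ/ℤ)²`, with its Haar probability measure `volume`. -/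
abbrev T2 := AddCircle (1 : ℝ) × AddCircle (1 : ℝ)

/-- The action of a matrix `A ∈ SL(2,ℤ)` on the `2`-torus:
`A·(x,y) = (a•x + b•y, c•x + d•y)`. -/
noncomputable def torusAct (A : SL2Z) (p : T2) : T2 :=
  ((A.1 0 0) • p.1 + (A.1 0 1) • p.2, (A.1 1 0) • p.1 + (A.1 1 1) • p.2)

instance nullSingleton_addCircle_one : NullSingletonClass (volume : Measure (AddCircle (1 : ℝ))) := by
  refine ⟨fun x => ?_⟩
  have h : Metric.closedBall x 0 = {x} := Metric.closedBall_zero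
  rw [← h, AddCircle.volume_closedBall]
  simp

/-- Almost every point of the circle has a multiple `N • x` of infinite order. -/
lemma ae_addOrderOf_zsmul (N : ℤ) (hN : N ≠ 0) :
    ∀ᵐ x : AddCircle (1 : ℝ), addOrderOf (N • x) = 0 := by
  have hc : (⋃ n : ℕ, {u : AddCircle (1 : ℝ) | (n + 1) • u = 0}).Countable :=
    Set.countable_iUnion fun n => (AddCircle.finite_torsion (1 : ℝ) n.succ_pos).countable
  filter_upwards [hc.ae_notMem volume] with x hx
  by_contra hne
  apply hx
  rw [addOrderOf_eq_zero_iff, not_not, isOfFinAddOrder_iff_nsmul_eq_zero] at hne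
  obtain ⟨n, hn, h⟩ := hne
  have h2 : (n * N.natAbs) • x = 0 := by
    rcases Int.natAbs_eq N with h3 | h3
    · rw [h3, natCast_zsmul, smul_smul] at h
      exact h
    · rw [h3, neg_smul, natCast_zsmul, smul_neg, neg_eq_zero, smul_smul] at h
      exact h
  have hpos : 0 < n * N.natAbs := Nat.mul_pos hn (Int.natAbs_pos.mpr hN)
  refine Set.mem_iUnion.mpr ⟨n * N.natAbs - 1, ?_⟩
  change (n * N.natAbs - 1 + 1) • x = 0
  rw [Nat.sub_add_cancel hpos, h2]

/-- A set invariant under a nontrivial shear depends on one coordinate only. -/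
lemma shear_inv (N : ℤ) (hN : N ≠ 0) (E : Set T2) (hE : MeasurableSet E)
    (h : ∀ᵐ p : T2, (p.1, N • p.1 + p.2) ∈ E ↔ p ∈ E) :
    ∃ F : Set (AddCircle (1 : ℝ)), MeasurableSet F ∧ ∀ᵐ p : T2, p ∈ E ↔ p.1 ∈ F := by
  have hm : Measurable fun x : AddCircle (1 : ℝ) => volume (Prod.mk x ⁻¹' E) :=
    measurable_measure_prodMk_left hE
  refine ⟨{x | volume (Prod.mk x ⁻¹' E) = 1}, hm (measurableSet_singleton 1), ?_⟩
  have hF : MeasurableSet {x : AddCircle (1 : ℝ) | volume (Prod.mk x ⁻¹' E) = 1} :=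
    hm (measurableSet_singleton 1)
  have hs : MeasurableSet {p : T2 | p ∈ E ↔ p.1 ∈
      {x : AddCircle (1 : ℝ) | volume (Prod.mk x ⁻¹' E) = 1}} := by
    exact MeasurableSet.iff hE (measurable_fst hF)
  refine (Measure.ae_prod_iff_ae_ae hs).mpr ?_
  have h' := Measure.ae_ae_of_ae_prod h
  filter_upwards [h', ae_addOrderOf_zsmul N hN] with x hx ho
  have herg := (AddCircle.ergodic_add_left (p := (1 : ℝ))).mpr ho
  have hsl : MeasurableSet (Prod.mk x ⁻¹' E) := measurable_prodMk_left hE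
  have key := herg.quasiErgodic.ae_empty_or_univ₀ hsl.nullMeasurableSet
    (by
      filter_upwards [hx] with y hy
      exact propext hy)
  rcases key with k | k
  · have hv : volume (Prod.mk x ⁻¹' E) = 0 := ae_eq_empty.mp k
    filter_upwards [measure_eq_zero_iff_ae_notMem.mp hv] with y hy
    have : ¬ (volume (Prod.mk x ⁻¹' E) = 1) := by simp [hv]
    exact iff_of_false hy this
  · have hv : volume (Prod.mk x ⁻¹' E) = 1 := by
      rw [measure_congr k]; simp
    filter_upwards [k.mem_iff] with y hy
    exact iff_of_true (hy.mpr trivial) hv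

lemma ae_of_symmDiff {S E : Set T2} (h : volume (S ∆ E) = 0) :
    ∀ᵐ p : T2, p ∈ S ↔ p ∈ E :=
  (measure_symmDiff_eq_zero_iff.mp h).mem_iff

def lowU : SL2Z := ⟨!![1, 0; 1, 1], by simp [Matrix.det_fin_two]⟩
def upU : SL2Z := ⟨!![1, 1; 0, 1], by simp [Matrix.det_fin_two]⟩

lemma lowU_pow (n : ℕ) : (lowU ^ n).1 = !![1, 0; (n : ℤ), 1] := by
  induction n with
  | zero => simp [Matrix.one_fin_two]
  | succ n ih =>
    rw [pow_succ, Matrix.SpecialLinearGroup.coe_mul, ih]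
    simp [lowU]

lemma upU_pow (n : ℕ) : (upU ^ n).1 = !![1, (n : ℤ); 0, 1] := by
  induction n with
  | zero => simp [Matrix.one_fin_two]
  | succ n ih =>
    rw [pow_succ, Matrix.SpecialLinearGroup.coe_mul, ih]
    simp [upU, add_comm]

lemma low_act (n : ℕ) (p : T2) :
    torusAct (lowU ^ n) p = (p.1, n • p.1 + p.2) := by
  unfold torusAct
  rw [lowU_pow]
  simp

lemma up_act (n : ℕ) (p : T2) :
    torusAct (upU ^ n) p = (p.1 + n • p.2, p.2) := by
  unfold torusAct
  rw [upU_pow]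
  simp

lemma low_image (n : ℕ) (E : Set T2) (p : T2) :
    p ∈ torusAct (lowU ^ n) '' E ↔ (p.1, (-(n : ℤ)) • p.1 + p.2) ∈ E := by
  constructor
  · rintro ⟨q, hq, rfl⟩
    simpa [low_act] using hq
  · intro h
    exact ⟨_, h, by simp [low_act]⟩

lemma up_image (n : ℕ) (E : Set T2) (p : T2) :
    p ∈ torusAct (upU ^ n) '' E ↔ ((-(n : ℤ)) • p.2 + p.1, p.2) ∈ E := by
  constructor
  · rintro ⟨q, hq, rfl⟩
    simpa [up_act] using hq
  · intro h
    exact ⟨_, h, by simp [up_act]⟩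

/-- The action of any finite-index subgroup `Γ₀ ≤ SL(2,ℤ)` on the `2`-torus is ergodic
for the Haar probability measure. -/
theorem finiteIndex_SL2Z_torus_ergodic
    (Γ₀ : Subgroup SL2Z) (hΓ : Γ₀.FiniteIndex)
    (E : Set T2) (hE : MeasurableSet E)
    (hinv : ∀ A ∈ Γ₀, volume ((torusAct A '' E) ∆ E) = 0) :
    volume E = 0 ∨ volume E = 1 := by
  obtain ⟨n, hn, -, hnm⟩ := Subgroup.exists_pow_mem_of_index_ne_zero hΓ.index_ne_zero lowU
  obtain ⟨m, hm, -, hmm⟩ := Subgroup.exists_pow_mem_of_index_ne_zero hΓ.index_ne_zero upU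
  have hlow := ae_of_symmDiff (hinv _ hnm)
  have hup := ae_of_symmDiff (hinv _ hmm)
  simp only [low_image] at hlow
  simp only [up_image] at hup
  have hsw : MeasurePreserving (Prod.swap : T2 → T2) volume volume :=
    Measure.measurePreserving_swap
  obtain ⟨F, hF, hEF⟩ := shear_inv (-(n : ℤ)) (by omega) E hE hlow
  obtain ⟨G, hG, hEG⟩ := shear_inv (-(m : ℤ)) (by omega) (Prod.swap ⁻¹' E)
    (measurable_swap hE) (hsw.quasiMeasurePreserving.ae hup)
  have hEG' := hsw.quasiMeasurePreserving.ae hEG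
  have e1 : volume E = volume F := by
    have : E =ᵐ[volume] (F ×ˢ Set.univ : Set T2) := by
      filter_upwards [hEF] with p hp
      exact propext (hp.trans (by simp [Set.mem_prod] : _ ↔ p ∈ F ×ˢ Set.univ))
    rw [measure_congr this, Measure.volume_eq_prod, Measure.prod_prod]; simp
  have e2 : volume E = volume G := by
    have : E =ᵐ[volume] (Set.univ ×ˢ G : Set T2) := by
      filter_upwards [hEG'] with p hp
      exact propext (Iff.trans hp (by simp [Set.mem_prod] : _ ↔ p ∈ Set.univ ×ˢ G))
    rw [measure_congr this, Measure.volume_eq_prod, Measure.prod_prod]; simp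
  have e3 : volume E = volume E * volume E := by
    have : E =ᵐ[volume] (F ×ˢ G : Set T2) := by
      filter_upwards [hEF, hEG'] with p hp hp'
      have hp'' : p ∈ E ↔ p.2 ∈ G := hp'
      have : p ∈ E ↔ p ∈ F ×ˢ G := by
        rw [Set.mem_prod]; tauto
      exact propext this
    calc volume E = volume F * volume G := by
          rw [measure_congr this, Measure.volume_eq_prod, Measure.prod_prod]
      _ = _ := by rw [← e1, ← e2]
  by_cases h0 : volume E = 0
  · exact Or.inl h0
  · right
    have hfin : volume E ≠ ⊤ := by rw [e1]; exact measure_ne_top _ _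
    have := ENNReal.mul_right_inj h0 hfin (b := volume E) (c := 1)
    exact this.mp (by rw [mul_one, ← e3])
end

section
/- For every integer n ≥ 2 there exists a subgroup H of SL(2,ℤ) of finite index such that H is isomorphic (as a group) to the free group Fₙ on n generators. -/
open ModularGroup UpperHalfPlane
open scoped MatrixGroups Pointwise

namespace FreeSL2

/-- The lower triangular Sanov generator. -/
def y : SL(2, ℤ) := S⁻¹ * T ^ (-2 : ℤ) * S

/-- The free generators. -/
def gen (m : ℕ) : Option (Fin m) → SL(2, ℤ)
  | none => T ^ (2 * m : ℤ)
  | some i => T ^ (2 * (i : ℕ) : ℤ) * y * T ^ (-(2 * (i : ℕ)) : ℤ)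

/-- Attracting regions. -/
def X (m : ℕ) : Option (Fin m) → Set ℍ
  | none => {z | 2 * (m : ℝ) - 1 ≤ z.re}
  | some i => {z | (S • (T ^ (-(2 * (i : ℕ)) : ℤ) • z)).re ≤ -1}

/-- Repelling regions. -/
def Y (m : ℕ) : Option (Fin m) → Set ℍ
  | none => {z | z.re < -1}
  | some i => {z | 1 < (S • (T ^ (-(2 * (i : ℕ)) : ℤ) • z)).re}

lemma re_S_smul (z : ℍ) : (S • z).re = -z.re / (z.re ^ 2 + z.im ^ 2) := by
  rw [modular_S_smul, ← coe_re, coe_mk, Complex.inv_re]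
  simp [Complex.normSq_apply, pow_two]

lemma re_S_le {z : ℍ} (h : (S • z).re ≤ -1) : 0 < z.re ∧ z.re < 1 := by
  have hi := z.im_pos
  have hp : 0 < z.re ^ 2 + z.im ^ 2 := by positivity
  rw [re_S_smul, div_le_iff₀ hp] at h
  constructor <;> nlinarith

lemma re_S_gt {z : ℍ} (h : 1 < (S • z).re) : -1 < z.re ∧ z.re < 0 := by
  have hi := z.im_pos
  have hp : 0 < z.re ^ 2 + z.im ^ 2 := by positivity
  rw [re_S_smul, lt_div_iff₀ hp] at h
  constructor <;> nlinarith

lemma X_some {m : ℕ} {i : Fin m} {z : ℍ} (h : z ∈ X m (some i)) :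
    2 * ((i : ℕ) : ℝ) < z.re ∧ z.re < 2 * ((i : ℕ) : ℝ) + 1 := by
  have := re_S_le h
  rw [re_T_zpow_smul] at this
  push_cast at this
  constructor <;> linarith

lemma Y_some {m : ℕ} {i : Fin m} {z : ℍ} (h : z ∈ Y m (some i)) :
    2 * ((i : ℕ) : ℝ) - 1 < z.re ∧ z.re < 2 * ((i : ℕ) : ℝ) := by
  have := re_S_gt h
  rw [re_T_zpow_smul] at this
  push_cast at this
  constructor <;> linarith

lemma fin_cast {m : ℕ} (i : Fin m) : ((i : ℕ) : ℝ) + 1 ≤ m := by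
  exact_mod_cast i.2

lemma gen_injective (m : ℕ) (hm : 1 ≤ m) : Function.Injective (FreeGroup.lift (gen m)) := by
  have : Nonempty (Fin m) := ⟨⟨0, hm⟩⟩
  have hne : ∀ i j : Fin m, i ≠ j →
      ((i : ℕ) : ℝ) + 1 ≤ (j : ℕ) ∨ ((j : ℕ) : ℝ) + 1 ≤ (i : ℕ) := by
    intro i j h
    have h' : (i : ℕ) ≠ j := fun e => h (Fin.ext e)
    rcases lt_or_gt_of_ne h' with h | h
    · left; exact_mod_cast h
    · right; exact_mod_cast h
  have hm' : (1 : ℝ) ≤ m := by exact_mod_cast hm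
  apply FreeGroup.injective_lift_of_ping_pong (gen m) (X m) (Y m)
  · rintro (_ | i)
    · refine ⟨T ^ (2 * m : ℤ) • I, ?_⟩
      simp only [X, Set.mem_ofPred_eq, re_T_zpow_smul]
      push_cast
      simp
    · refine ⟨T ^ (2 * (i : ℕ) : ℤ) • S⁻¹ • T ^ (-1 : ℤ) • I, ?_⟩
      simp only [X, Set.mem_ofPred_eq]
      rw [zpow_neg, inv_smul_smul, smul_inv_smul, re_T_zpow_smul]
      simp
  · rintro (_ | i) (_ | j) h <;> refine Set.disjoint_left.mpr fun z h1 h2 => ?_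
    · exact h rfl
    · have := X_some h2; have := fin_cast j; simp only [X, Set.mem_ofPred_eq] at h1; linarith
    · have := X_some h1; have := fin_cast i; simp only [X, Set.mem_ofPred_eq] at h2; linarith
    · have := X_some h1; have := X_some h2
      rcases hne i j (fun e => h (by rw [e])) with h | h <;> linarith
  · rintro (_ | i) (_ | j) h <;> refine Set.disjoint_left.mpr fun z h1 h2 => ?_
    · exact h rfl
    · have := Y_some h2; have : (0 : ℝ) ≤ (j : ℕ) := by positivity
      simp only [Y, Set.mem_ofPred_eq] at h1; linarith
    · have := Y_some h1; have : (0 : ℝ) ≤ (i : ℕ) := by positivity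
      simp only [Y, Set.mem_ofPred_eq] at h2; linarith
    · have := Y_some h1; have := Y_some h2
      rcases hne i j (fun e => h (by rw [e])) with h | h <;> linarith
  · rintro (_ | i) (_ | j) <;> refine Set.disjoint_left.mpr fun z h1 h2 => ?_
    · simp only [X, Y, Set.mem_ofPred_eq] at h1 h2; linarith
    · have := Y_some h2; have := fin_cast j; simp only [X, Set.mem_ofPred_eq] at h1; linarith
    · have := X_some h1; have : (0 : ℝ) ≤ (i : ℕ) := by positivity
      simp only [Y, Set.mem_ofPred_eq] at h2; linarith
    · have := X_some h1; have := Y_some h2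
      by_cases e : i = j
      · subst e; linarith
      · rcases hne i j e with h | h <;> linarith
  · rintro (_ | i) _ ⟨z, hz, rfl⟩
    · simp only [X, Y, gen, Set.mem_ofPred_eq, Set.mem_compl_iff, not_lt] at hz ⊢
      rw [re_T_zpow_smul]; push_cast; linarith
    · simp only [X, Y, gen, y, Set.mem_ofPred_eq, Set.mem_compl_iff, not_lt] at hz ⊢
      simp only [mul_smul, zpow_neg _ (2 * ((i : ℕ) : ℤ)), inv_smul_smul, smul_inv_smul] at hz ⊢
      rw [re_T_zpow_smul]; push_cast; linarith
  · rintro (_ | i) _ ⟨z, hz, rfl⟩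
    · simp only [X, Y, gen, Pi.inv_apply, Set.mem_ofPred_eq, Set.mem_compl_iff, not_le] at hz ⊢
      rw [← zpow_neg, re_T_zpow_smul]; push_cast; linarith
    · simp only [X, Y, gen, y, Pi.inv_apply, Set.mem_ofPred_eq, Set.mem_compl_iff, not_le] at hz ⊢
      simp only [mul_inv_rev, mul_smul, zpow_neg, inv_inv, inv_smul_smul, smul_inv_smul] at hz ⊢
      rw [re_T_zpow_smul]; push_cast; linarith

/-- Coset representatives, up to sign, of the Sanov subgroup. -/
def reps : List SL(2, ℤ) := [1, T, S, T * S, S * T, T * S * T]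

/-- Short words in the Sanov generators. -/
def words : List SL(2, ℤ) :=
  [1, T * T, (T * T)⁻¹, y, y⁻¹, (T * T)⁻¹ * y]

lemma step_table : ∀ s ∈ [S, T], ∀ c ∈ reps, ∃ c' ∈ reps, ∃ h ∈ words,
    s * c = c' * h ∨ s * c = -(c' * h) := by
  decide +kernel

/-- The subgroup. -/
def K (m : ℕ) : Subgroup SL(2, ℤ) := (FreeGroup.lift (gen m)).range

lemma gen_mem (m : ℕ) (i) : gen m i ∈ K m := ⟨FreeGroup.of i, by simp⟩

/-- The union of the cosets of powers of the upper triangular generator. -/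
def W (m : ℕ) : Set SL(2, ℤ) := {g | ∃ j : ℤ, T ^ (2 * j) * g ∈ K m}

lemma conj_mem (m : ℕ) (hm : 1 ≤ m) (j : ℤ) : T ^ (2 * j) * y * T ^ (-(2 * j)) ∈ K m := by
  have hm0 : (0 : ℤ) < m := by exact_mod_cast hm
  have h0 := Int.emod_nonneg j hm0.ne'
  have h1 := Int.emod_lt_of_pos j hm0
  let i : Fin m := ⟨(j % m).toNat, by omega⟩
  have hi : ((i : ℕ) : ℤ) = j % m := by simp [i, h0]
  have ha := gen_mem m none
  have hb := gen_mem m (some i)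
  simp only [gen, hi] at ha hb
  have hj : j = m * (j / m) + j % m := (Int.mul_ediv_add_emod j m).symm
  have := mul_mem (mul_mem ((K m).zpow_mem ha (j / m)) hb) ((K m).zpow_mem ha (-(j / m)))
  convert this using 1
  rw [← zpow_mul, ← zpow_mul]
  have e1 : (2 * j : ℤ) = 2 * m * (j / m) + 2 * (j % m) := by linear_combination 2 * hj
  have e2 : (-(2 * j) : ℤ) = -(2 * (j % m)) + 2 * m * (-(j / m)) := by linear_combination -2 * hj
  rw [e2, e1, zpow_add, zpow_add]
  group

lemma W_word (m : ℕ) (hm : 1 ≤ m) : ∀ h ∈ words, ∀ w ∈ W m, h * w ∈ W m := by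
  have hx : ∀ w ∈ W m, (T * T) * w ∈ W m := by
    rintro w ⟨j, hj⟩
    refine ⟨j - 1, ?_⟩
    convert hj using 1
    rw [show (2 * (j - 1) : ℤ) = 2 * j - 1 - 1 by ring, zpow_sub_one, zpow_sub_one]
    group
  have hx' : ∀ w ∈ W m, (T * T)⁻¹ * w ∈ W m := by
    rintro w ⟨j, hj⟩
    refine ⟨j + 1, ?_⟩
    convert hj using 1
    rw [show (2 * (j + 1) : ℤ) = 2 * j + 1 + 1 by ring, zpow_add_one, zpow_add_one]
    group
  have hy : ∀ w ∈ W m, y * w ∈ W m := by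
    rintro w ⟨j, hj⟩
    refine ⟨j, ?_⟩
    convert mul_mem (conj_mem m hm j) hj using 1
    group
  have hy' : ∀ w ∈ W m, y⁻¹ * w ∈ W m := by
    rintro w ⟨j, hj⟩
    refine ⟨j, ?_⟩
    convert mul_mem (inv_mem (conj_mem m hm j)) hj using 1
    group
  intro h hh w hw
  simp only [words, List.mem_cons, List.not_mem_nil, or_false] at hh
  rcases hh with rfl | rfl | rfl | rfl | rfl | rfl
  · simpa using hw
  · exact hx w hw
  · exact hx' w hw
  · exact hy w hw
  · exact hy' w hw
  · rw [mul_assoc]; exact hx' _ (hy w hw)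

/-- The union of all cosets found. -/
def U (m : ℕ) : Set SL(2, ℤ) := {g | ∃ c ∈ reps, ∃ w ∈ W m, g = c * w ∨ g = -(c * w)}

lemma U_step (m : ℕ) (hm : 1 ≤ m) : ∀ s ∈ [S, T], ∀ g ∈ U m, s * g ∈ U m := by
  rintro s hs g ⟨c, hc, w, hw, hg⟩
  obtain ⟨c', hc', h, hh, e⟩ := step_table s hs c hc
  refine ⟨c', hc', h * w, W_word m hm h hh w hw, ?_⟩
  rcases hg with rfl | rfl <;> rcases e with e | e
  · left; rw [← mul_assoc, e, mul_assoc]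
  · right; rw [← mul_assoc, e, neg_mul, mul_assoc]
  · right; rw [mul_neg, ← mul_assoc, e, mul_assoc]
  · left; rw [mul_neg, ← mul_assoc, e, neg_mul, neg_neg, mul_assoc]

lemma U_all (m : ℕ) (hm : 1 ≤ m) (g : SL(2, ℤ)) : g ∈ U m := by
  have hS : ∀ g ∈ U m, S * g ∈ U m := U_step m hm S (by simp)
  have hT : ∀ g ∈ U m, T * g ∈ U m := U_step m hm T (by simp)
  have hg : g ∈ Subgroup.closure {S, T} := by
    rw [SpecialLinearGroup.SL2Z_generators]; trivial
  induction hg using Subgroup.closure_induction_left with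
  | one => exact ⟨1, by simp [reps], 1, ⟨0, by simp⟩, by simp⟩
  | mul_left x hx z _ ih =>
    rcases hx with rfl | rfl
    · exact hS _ ih
    · exact hT _ ih
  | inv_mul_cancel x hx z _ ih =>
    rcases hx with rfl | rfl
    · have : S⁻¹ = S * S * S := by decide
      rw [this, mul_assoc, mul_assoc]
      exact hS _ (hS _ (hS _ ih))
    · rw [← T_S_rel]
      simp only [smul_eq_mul, mul_assoc]
      exact hS _ (hS _ (hS _ (hT _ (hS _ (hT _ (hS _ ih))))))

lemma K_finiteIndex (m : ℕ) (hm : 1 ≤ m) : (K m).FiniteIndex := by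
  have hm0 : (0 : ℤ) < m := by exact_mod_cast hm
  let f : Fin 6 × Fin m × Bool → SL(2, ℤ) ⧸ K m := fun p =>
    let g : SL(2, ℤ) := reps.get p.1 * T ^ (-(2 * (p.2.1 : ℕ)) : ℤ)
    ((if p.2.2 then g else -g : SL(2, ℤ)) : SL(2, ℤ) ⧸ K m)
  have hf : Function.Surjective f := by
    intro q
    obtain ⟨g, rfl⟩ := QuotientGroup.mk_surjective q
    obtain ⟨c, hc, w, ⟨j, hj⟩, hg⟩ := U_all m hm g
    obtain ⟨k, rfl⟩ := List.get_of_mem hc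
    have h0 := Int.emod_nonneg j hm0.ne'
    have h1 := Int.emod_lt_of_pos j hm0
    let i : Fin m := ⟨(j % m).toNat, by omega⟩
    have hi : ((i : ℕ) : ℤ) = j % m := by simp [i, h0]
    have hw : T ^ (2 * (i : ℕ) : ℤ) * w ∈ K m := by
      have ha := gen_mem m none
      simp only [gen] at ha
      have := mul_mem ((K m).zpow_mem ha (-(j / m))) hj
      convert this using 1
      rw [← zpow_mul, ← mul_assoc, ← zpow_add, hi, Int.emod_def]
      congr 2
      ring
    rcases hg with rfl | rfl
    · refine ⟨(k, i, true), ?_⟩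
      simp only [f, if_true]
      rw [QuotientGroup.eq]
      convert hw using 1
      group
    · refine ⟨(k, i, false), ?_⟩
      simp only [f, Bool.false_eq_true, if_false]
      rw [QuotientGroup.eq]
      convert hw using 1
      rw [inv_neg, neg_mul_neg]
      group
  have : Finite (SL(2, ℤ) ⧸ K m) := Finite.of_surjective f hf
  exact Subgroup.finiteIndex_of_finite_quotient

end FreeSL2

/-- For every `n ≥ 2`, `SL(2,ℤ)` contains a finite-index subgroup isomorphic to the free
group on `n` generators. -/
theorem SL2Z_contains_free_finiteIndex (n : ℕ) (hn : 2 ≤ n) :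
    ∃ H : Subgroup (Matrix.SpecialLinearGroup (Fin 2) ℤ),
      H.FiniteIndex ∧ Nonempty (H ≃* FreeGroup (Fin n)) := by
  obtain ⟨m, rfl⟩ : ∃ m, n = m + 1 := ⟨n - 1, by omega⟩
  have hm : 1 ≤ m := by omega
  refine ⟨FreeSL2.K m, FreeSL2.K_finiteIndex m hm, ⟨?_⟩⟩
  exact (MonoidHom.ofInjective (FreeSL2.gen_injective m hm)).symm.trans
    (FreeGroup.freeGroupCongr (finSuccEquiv m).symm)
end

section
/- The action of SL(2,ℤ) on the 2-torus 𝕋² = (ℝ/ℤ)² with Haar probability measure μ is strongly ergodic: for every sequence (Eₙ) of measurable subsets of 𝕋² such that μ((A·Eₙ) Δ Eₙ) → 0 as n → ∞ for every A ∈ SL(2,ℤ), one has μ(Eₙ)·(1 − μ(Eₙ)) → 0 as n → ∞. -/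
open Matrix Filter MeasureTheory
open scoped ComplexOrder symmDiff

section helpers

lemma gap_step (c : ℤ × ℤ → ℂ) (hs : Summable (fun k => ‖c k‖ ^ 2)) (T : ℤ × ℤ → ℤ × ℤ)
    (hT : Function.Injective T) (D : ℝ) (hD : HasSum (fun k => ‖c (T k) - c k‖ ^ 2) D)
    (S S' : Set (ℤ × ℤ)) (hS : Set.MapsTo T S S') :
    ∑' k, S.indicator (fun k => ‖c k‖ ^ 2) k ≤
      (3 / 2) * ∑' k, S'.indicator (fun k => ‖c k‖ ^ 2) k + 3 * D := by
  have h1 : Summable (S.indicator (fun k => ‖c k‖ ^ 2)) := hs.indicator S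
  have h2 : Summable (S'.indicator (fun k => ‖c k‖ ^ 2)) := hs.indicator S'
  have h3 : Summable (fun k => S'.indicator (fun k => ‖c k‖ ^ 2) (T k)) := h2.comp_injective hT
  have h4 : ∑' k, S'.indicator (fun k => ‖c k‖ ^ 2) (T k) ≤
      ∑' k, S'.indicator (fun k => ‖c k‖ ^ 2) k :=
    tsum_comp_le_tsum_of_inj h2
      (fun k => Set.indicator_nonneg (fun _ _ => by positivity) k) hT
  have h5 : ∑' k, S.indicator (fun k => ‖c k‖ ^ 2) k ≤
      ∑' k, ((3 / 2) * S'.indicator (fun k => ‖c k‖ ^ 2) (T k) + 3 * ‖c (T k) - c k‖ ^ 2) := by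
    refine h1.tsum_le_tsum (fun k => ?_) ((h3.mul_left _).add (hD.summable.mul_left _))
    by_cases hk : k ∈ S
    · rw [Set.indicator_of_mem hk, Set.indicator_of_mem (hS hk)]
      have h6 : ‖c k‖ ≤ ‖c (T k)‖ + ‖c (T k) - c k‖ := by
        have := norm_sub_le (c (T k)) (c (T k) - c k)
        simpa using this
      have h7 : ‖c k‖ ^ 2 ≤ (‖c (T k)‖ + ‖c (T k) - c k‖) ^ 2 :=
        pow_le_pow_left₀ (norm_nonneg _) h6 2
      nlinarith [sq_nonneg (‖c (T k)‖ - 2 * ‖c (T k) - c k‖)]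
    · rw [Set.indicator_of_notMem hk]
      have : 0 ≤ S'.indicator (fun k => ‖c k‖ ^ 2) (T k) :=
        Set.indicator_nonneg (fun _ _ => by positivity) _
      positivity
  rw [(h3.mul_left _).tsum_add (hD.summable.mul_left _), tsum_mul_left, tsum_mul_left,
    hD.tsum_eq] at h5
  linarith

lemma gap (c : ℤ × ℤ → ℂ) (hs : Summable (fun k => ‖c k‖ ^ 2)) (D₁ D₂ D₃ : ℝ)
    (h₁ : HasSum (fun k : ℤ × ℤ => ‖c (k.1 + k.2, k.2) - c k‖ ^ 2) D₁)
    (h₂ : HasSum (fun k : ℤ × ℤ => ‖c (k.1, k.1 + k.2) - c k‖ ^ 2) D₂)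
    (h₃ : HasSum (fun k : ℤ × ℤ => ‖c (-k.2, k.1) - c k‖ ^ 2) D₃) :
    ∑' k, ‖c k‖ ^ 2 ≤ ‖c 0‖ ^ 2 + 33 * (D₁ + D₂ + D₃) := by
  set w : ℤ × ℤ → ℝ := fun k => ‖c k‖ ^ 2 with hw
  let P : Set (ℤ × ℤ) := {k | (0 < k.1 ∧ 0 ≤ k.2) ∨ (k.1 < 0 ∧ k.2 ≤ 0)}
  let Q : Set (ℤ × ℤ) := {k | (k.1 ≤ 0 ∧ 0 < k.2) ∨ (0 ≤ k.1 ∧ k.2 < 0)}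
  let Pa : Set (ℤ × ℤ) := {k | (k.2 < k.1 ∧ 0 ≤ k.2) ∨ (k.1 < k.2 ∧ k.2 ≤ 0)}
  let Pb : Set (ℤ × ℤ) := {k | (0 < k.1 ∧ k.1 ≤ k.2) ∨ (k.1 < 0 ∧ k.2 ≤ k.1)}
  have e1 := gap_step c hs (fun k => (k.1 + k.2, k.2))
    (by rintro ⟨a, b⟩ ⟨a', b'⟩ h; simp only [Prod.mk.injEq] at h ⊢; omega) D₁ h₁ P Pa
    (by rintro ⟨a, b⟩ h; simp only [P, Pa, Set.mem_ofPred_eq] at h ⊢; omega)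
  have e2 := gap_step c hs (fun k => (k.1, k.1 + k.2))
    (by rintro ⟨a, b⟩ ⟨a', b'⟩ h; simp only [Prod.mk.injEq] at h ⊢; omega) D₂ h₂ P Pb
    (by rintro ⟨a, b⟩ h; simp only [P, Pb, Set.mem_ofPred_eq] at h ⊢; omega)
  have e3 := gap_step c hs (fun k => (-k.2, k.1))
    (by rintro ⟨a, b⟩ ⟨a', b'⟩ h; simp only [Prod.mk.injEq] at h ⊢; omega) D₃ h₃ Q P
    (by rintro ⟨a, b⟩ h; simp only [P, Q, Set.mem_ofPred_eq] at h ⊢; omega)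
  have e4 : ∑' k, Pa.indicator w k + ∑' k, Pb.indicator w k = ∑' k, P.indicator w k := by
    rw [← (hs.indicator Pa).tsum_add (hs.indicator Pb)]
    congr 1
    have hdis : Disjoint Pa Pb := by
      rw [Set.disjoint_left]
      rintro ⟨a, b⟩ h h'
      simp only [Pa, Pb, Set.mem_ofPred_eq] at h h'; omega
    refine (Set.indicator_union_of_disjoint hdis w).symm.trans ?_
    congr 1
    ext ⟨a, b⟩
    simp only [P, Pa, Pb, Set.mem_ofPred_eq, Set.mem_union]; omega
  have e5 : ∑' k, w k = w 0 + (∑' k, P.indicator w k + ∑' k, Q.indicator w k) := by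
    have h0 : ∑' k, ({0} : Set (ℤ × ℤ)).indicator w k = w 0 := by
      rw [tsum_eq_single 0]
      · simp
      · intro b hb; simp [hb]
    rw [← h0, ← (hs.indicator P).tsum_add (hs.indicator Q),
      ← (hs.indicator _).tsum_add ((hs.indicator P).add (hs.indicator Q))]
    congr 1
    ext ⟨a, b⟩
    have hd : ((a, b) = ((0 : ℤ × ℤ)) ∧ (a,b) ∉ P ∧ (a,b) ∉ Q) ∨
        ((a, b) ≠ ((0 : ℤ × ℤ)) ∧ (a,b) ∈ P ∧ (a,b) ∉ Q) ∨
        ((a, b) ≠ ((0 : ℤ × ℤ)) ∧ (a,b) ∉ P ∧ (a,b) ∈ Q) := by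
      simp only [P, Q, Set.mem_ofPred_eq, Prod.ext_iff, Prod.fst_zero, Prod.snd_zero, ne_eq]
      omega
    rcases hd with ⟨i, j, l⟩ | ⟨i, j, l⟩ | ⟨i, j, l⟩ <;> simp only [Set.indicator, Set.mem_singleton_iff, j, l] <;> simp [i]
  have d1 : 0 ≤ D₁ := h₁.nonneg fun _ => by positivity
  have d2 : 0 ≤ D₂ := h₂.nonneg fun _ => by positivity
  have d3 : 0 ≤ D₃ := h₃.nonneg fun _ => by positivity
  change _ ≤ w 0 + _
  rw [e5]
  linarith

noncomputable def cf (f : T2 → ℂ) (k : ℤ × ℤ) : ℂ :=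
  ∫ p : T2, (fourier (-k.1) p.1 * fourier (-k.2) p.2) * f p

lemma vol_haar : (volume : Measure (AddCircle (1 : ℝ))) = AddCircle.haarAddCircle := by
  rw [AddCircle.volume_eq_smul_haarAddCircle]; simp

instance : IsProbabilityMeasure (volume : Measure (AddCircle (1 : ℝ))) := by
  rw [vol_haar]; infer_instance

instance : Measure.IsAddHaarMeasure (volume : Measure T2) := by
  change Measure.IsAddHaarMeasure (Measure.prod volume volume)
  infer_instance

lemma parseval (f : T2 → ℂ) (hf : MemLp f 2 volume) :
    HasSum (fun k => ‖cf f k‖ ^ 2) (∫ p, ‖f p‖ ^ 2) := by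
  have hmp : MeasurePreserving (MeasurableEquiv.finTwoArrow (α := AddCircle (1 : ℝ)))
      (Measure.pi fun _ => AddCircle.haarAddCircle) (volume : Measure T2) := by
    have := measurePreserving_finTwoArrow (AddCircle.haarAddCircle (T := 1))
    rw [← vol_haar] at this ⊢
    exact this
  have hg := hf.comp_measurePreserving hmp
  have key := UnitAddTorus.hasSum_sq_mFourierCoeff (d := Fin 2) (hg.toLp _)
  have hae := hg.coeFn_toLp
  have hint : ∫ p, ‖f p‖ ^ 2 = ∫ t, ‖hg.toLp _ t‖ ^ 2 ∂(Measure.pi fun _ => AddCircle.haarAddCircle) := by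
    rw [← hmp.integral_comp']
    refine integral_congr_ae ?_
    filter_upwards [hae] with t ht
    rw [ht]; rfl
  have hc : ∀ k : Fin 2 → ℤ, UnitAddTorus.mFourierCoeff (hg.toLp _) k = cf f (k 0, k 1) := by
    intro k
    unfold cf
    rw [← hmp.integral_comp']
    refine integral_congr_ae ?_
    filter_upwards [hae] with t ht
    rw [ht]
    simp [UnitAddTorus.mFourier, Fin.prod_univ_two, MeasurableEquiv.finTwoArrow]
  rw [hint]
  simp_rw [hc] at key
  rw [← (finTwoArrowEquiv ℤ).hasSum_iff]
  exact key

noncomputable def actHom (A : SL2Z) : T2 →+ T2 where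
  toFun := torusAct A
  map_zero' := by simp [torusAct]
  map_add' p q := by
    simp only [torusAct, Prod.fst_add, Prod.snd_add, smul_add, Prod.mk_add_mk, Prod.mk.injEq]
    constructor <;> abel

lemma act_mul (A B : SL2Z) (p : T2) : torusAct (A * B) p = torusAct A (torusAct B p) := by
  simp only [torusAct, Matrix.SpecialLinearGroup.coe_mul, Matrix.mul_apply, Fin.sum_univ_two,
    add_smul, mul_smul, smul_add, Prod.mk.injEq]
  constructor <;> abel

lemma act_one (p : T2) : torusAct 1 p = p := by
  simp [torusAct]

lemma act_inv (A : SL2Z) (p : T2) : torusAct A (torusAct A⁻¹ p) = p := by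
  rw [← act_mul, mul_inv_cancel, act_one]

lemma act_inv' (A : SL2Z) (p : T2) : torusAct A⁻¹ (torusAct A p) = p := by
  rw [← act_mul, inv_mul_cancel, act_one]

lemma act_cont (A : SL2Z) : Continuous (torusAct A) := by
  unfold torusAct; fun_prop

lemma act_mp (A : SL2Z) : MeasurePreserving (torusAct A) volume volume :=
  AddMonoidHom.measurePreserving (f := actHom A) (act_cont A)
    (fun p => ⟨_, act_inv A p⟩) rfl

lemma image_eq (A : SL2Z) (E : Set T2) : torusAct A '' E = torusAct A⁻¹ ⁻¹' E :=
  congrFun (Set.image_eq_preimage_of_inverse (act_inv' A) (act_inv A)) E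

lemma cf_image (A : SL2Z) (E : Set T2) (hE : MeasurableSet E) (k : ℤ × ℤ) :
    cf ((torusAct A '' E).indicator 1) k =
      cf (E.indicator 1) (A.1 0 0 * k.1 + A.1 1 0 * k.2, A.1 0 1 * k.1 + A.1 1 1 * k.2) := by
  have hmeas : MeasurableSet (torusAct A '' E) := by
    rw [image_eq]; exact (act_cont _).measurable hE
  unfold cf
  rw [← (act_mp A).map_eq, integral_map (act_cont A).aemeasurable]
  · rw [(act_mp A).map_eq]
    congr 1
    ext p
    have h1 : (torusAct A '' E).indicator (1 : T2 → ℂ) (torusAct A p) = E.indicator 1 p := by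
      have h2 : torusAct A p ∈ torusAct A '' E ↔ p ∈ E := by
        rw [image_eq, Set.mem_preimage, act_inv']
      by_cases h3 : p ∈ E
      · rw [Set.indicator_of_mem h3, Set.indicator_of_mem (h2.2 h3)]; rfl
      · rw [Set.indicator_of_notMem h3, Set.indicator_of_notMem (fun h => h3 (h2.1 h))]
    rw [h1]
    congr 1
    simp only [torusAct]
    generalize A.1 0 0 = a
    generalize A.1 0 1 = b
    generalize A.1 1 0 = c
    generalize A.1 1 1 = d
    simp only [fourier_apply, smul_add, smul_smul, AddCircle.toCircle_add,
      Circle.coe_mul, add_smul, neg_add, neg_mul]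
    rw [mul_comm a, mul_comm b, mul_comm c, mul_comm d]
    ring
  · apply AEStronglyMeasurable.mul
    · apply Continuous.aestronglyMeasurable
      fun_prop
    · exact (measurable_one.indicator hmeas).aestronglyMeasurable

lemma memLp_ind (E : Set T2) (hE : MeasurableSet E) :
    MemLp (E.indicator (1 : T2 → ℂ)) 2 volume :=
  (memLp_const (1 : ℂ)).indicator hE

lemma cf_sub (f g : T2 → ℂ) (hf : MemLp f 2 volume) (hg : MemLp g 2 volume) (k : ℤ × ℤ) :
    cf (f - g) k = cf f k - cf g k := by
  have aux : ∀ h : T2 → ℂ, MemLp h 2 volume → Integrable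
      (fun p : T2 => (fourier (-k.1) p.1 * fourier (-k.2) p.2) * h p) volume := by
    intro h hh
    refine (hh.integrable one_le_two).bdd_mul (c := 1) ?_ ?_
    · apply Continuous.aestronglyMeasurable
      fun_prop
    · refine Eventually.of_forall fun p => ?_
      rw [norm_mul, fourier_apply, fourier_apply, Circle.norm_coe, Circle.norm_coe, one_mul]
  unfold cf
  rw [← integral_sub (aux f hf) (aux g hg)]
  simp [mul_sub]

lemma hasSum_diff (A : SL2Z) (E : Set T2) (hE : MeasurableSet E) :
    HasSum (fun k : ℤ × ℤ => ‖cf (E.indicator 1)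
        (A.1 0 0 * k.1 + A.1 1 0 * k.2, A.1 0 1 * k.1 + A.1 1 1 * k.2)
        - cf (E.indicator 1) k‖ ^ 2)
      (volume.real ((torusAct A '' E) ∆ E)) := by
  have hmeas : MeasurableSet (torusAct A '' E) := by
    rw [image_eq]; exact (act_cont _).measurable hE
  have h := parseval _ ((memLp_ind _ hmeas).sub (memLp_ind E hE))
  simp_rw [cf_sub _ _ (memLp_ind _ hmeas) (memLp_ind E hE), cf_image A E hE] at h
  convert h using 1
  rw [← integral_indicator_one (hmeas.symmDiff hE)]
  congr 1
  ext p
  by_cases h1 : p ∈ torusAct A '' E <;> by_cases h2 : p ∈ E <;>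
    simp only [Set.indicator, Set.mem_symmDiff, Pi.sub_apply, h1, h2] <;> simp

lemma main_bound (E : Set T2) (hE : MeasurableSet E) (A B C : SL2Z)
    (hA : A.1 = !![1, 0; 1, 1]) (hB : B.1 = !![1, 1; 0, 1]) (hC : C.1 = !![0, 1; -1, 0]) :
    volume.real E * (1 - volume.real E) ≤ 33 * (volume.real ((torusAct A '' E) ∆ E) +
      volume.real ((torusAct B '' E) ∆ E) + volume.real ((torusAct C '' E) ∆ E)) := by
  have h := parseval _ (memLp_ind E hE)
  have h1 := hasSum_diff A E hE
  have h2 := hasSum_diff B E hE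
  have h3 := hasSum_diff C E hE
  simp only [hA, hB, hC] at h1 h2 h3
  have g := gap (cf (E.indicator 1)) h.summable _ _ _ (by simpa using h1) (by simpa using h2)
    (by simpa using h3)
  rw [h.tsum_eq] at g
  have e0 : cf (E.indicator 1) 0 = (volume.real E : ℂ) := by
    simp only [cf, Prod.fst_zero, Prod.snd_zero, neg_zero, fourier_zero, one_mul]
    rw [integral_indicator hE]
    simp
  have e1 : ∫ p, ‖E.indicator (1 : T2 → ℂ) p‖ ^ 2 = volume.real E := by
    rw [← integral_indicator_one hE]
    congr 1
    ext p
    by_cases h2 : p ∈ E <;> simp [h2]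
  rw [e0, e1] at g
  simp only [Complex.norm_real, Real.norm_eq_abs, sq_abs] at g
  nlinarith

end helpers

/-- The action of `SL(2,ℤ)` on the `2`-torus is strongly ergodic: any asymptotically
invariant sequence of measurable sets is trivial. -/
theorem SL2Z_torus_strongly_ergodic
    (E : ℕ → Set T2) (hE : ∀ n, MeasurableSet (E n))
    (hasymp : ∀ A : SL2Z,
      Tendsto (fun n => volume ((torusAct A '' E n) ∆ E n)) atTop (nhds 0)) :
    Tendsto (fun n => volume (E n) * (1 - volume (E n))) atTop (nhds 0) := by
  let A : SL2Z := ⟨!![1, 0; 1, 1], by simp [Matrix.det_fin_two]⟩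
  let B : SL2Z := ⟨!![1, 1; 0, 1], by simp [Matrix.det_fin_two]⟩
  let C : SL2Z := ⟨!![0, 1; -1, 0], by simp [Matrix.det_fin_two]⟩
  have hb : ∀ n, volume (E n) * (1 - volume (E n)) ≤ 33 * (volume ((torusAct A '' E n) ∆ E n) +
      volume ((torusAct B '' E n) ∆ E n) + volume ((torusAct C '' E n) ∆ E n)) := by
    intro n
    have h := main_bound (E n) (hE n) A B C rfl rfl rfl
    have hle : volume (E n) ≤ 1 := prob_le_one
    rw [← ENNReal.toReal_le_toReal]
    · rw [ENNReal.toReal_mul, ENNReal.toReal_sub_of_le hle (by simp), ENNReal.toReal_mul,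
        ENNReal.toReal_add (by simp) (by simp), ENNReal.toReal_add (by simp) (by simp)]
      simpa [Measure.real] using h
    · exact ENNReal.mul_ne_top (by simp) (by simp)
    · exact ENNReal.mul_ne_top (by simp) (by simp)
  have hl : Tendsto (fun n => 33 * (volume ((torusAct A '' E n) ∆ E n) +
      volume ((torusAct B '' E n) ∆ E n) + volume ((torusAct C '' E n) ∆ E n))) atTop (nhds 0) := by
    have := ENNReal.Tendsto.const_mul (a := 33) (((hasymp A).add (hasymp B)).add (hasymp C))
      (Or.inr (by simp))
    simpa using this
  exact tendsto_of_tendsto_of_tendsto_of_le_of_le tendsto_const_nhds hl (fun _ => bot_le) hb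
end
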